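/- arXiv:2412.01315 — 3 statements merged into one kernel-verified Lean document; each statement's English description precedes it below -/
import Mathlib

section
/- Let (Gₙ)ₙ be a sequence of bounded-degree Borel graphs on the Ellentuck space [ℕ]^ℕ and let f : ℕ → ℕ. Then there exist an infinite set A ⊆ ℕ and Borel sets Bₙ ⊆ [ℕ]^ℕ such that each Bₙ is f(n)-separated in Gₙ, and every infinite C ⊆ A belongs to Bₙ for infinitely many n. -/
/-- The Ellentuck space `[ℕ]^ℕ`: the infinite subsets of `ℕ`, as a subtype of
`Set ℕ ≃ 2^ℕ`, with the induced Borel σ-algebra. -/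
abbrev Ellentuck : Type := {A : Set ℕ // A.Infinite}

/-- A graph (symmetric irreflexive relation) has bounded degree if there is `d` such
that every vertex has at most `d` neighbors. -/
def BddDegreeGraph {X : Type*} (G : SimpleGraph X) : Prop :=
  ∃ d : ℕ, ∀ x : X, {y | G.Adj x y}.Finite ∧ {y | G.Adj x y}.ncard ≤ d

/-- A Borel graph: the adjacency relation is Borel as a subset of `X × X`. -/
def BorelGraph {X : Type*} [MeasurableSpace X] (G : SimpleGraph X) : Prop :=
  MeasurableSet {p : X × X | G.Adj p.1 p.2}

/-- `B` is `k`-separated in `G` if any two distinct points of `B` have graph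
distance `> k` (in particular points in different components are separated). -/
def SeparatedIn {X : Type*} (G : SimpleGraph X) (k : ℕ) (B : Set X) : Prop :=
  ∀ x ∈ B, ∀ y ∈ B, x ≠ y → (k : ℕ∞) < G.edist x y

section Ramsey

/-- A property of sets of naturals that passes to subsets and can be attained by shrinking any
infinite set. -/
def DenseHereditary (Q : Set ℕ → Prop) : Prop :=
  (∀ X Y, X ⊆ Y → Q Y → Q X) ∧ ∀ X : Set ℕ, X.Infinite → ∃ Y ⊆ X, Y.Infinite ∧ Q Y

theorem DenseHereditary.forall_mem_finset {ι : Type*} {Q : ι → Set ℕ → Prop}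
    (hQ : ∀ i, DenseHereditary (Q i)) (I : Finset ι) :
    DenseHereditary fun X => ∀ i ∈ I, Q i X := by
  classical
  refine ⟨fun X Y h hY i hi => (hQ i).1 X Y h (hY i hi), ?_⟩
  induction I using Finset.induction_on with
  | empty => exact fun X hX => ⟨X, subset_rfl, hX, by simp⟩
  | insert a I _ ih =>
    intro X hX
    obtain ⟨Y, hYX, hY, hQY⟩ := ih X hX
    obtain ⟨Z, hZY, hZ, hQZ⟩ := (hQ a).2 Y hY
    refine ⟨Z, hZY.trans hYX, hZ, fun i hi => ?_⟩
    obtain rfl | hi := Finset.mem_insert.1 hi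
    · exact hQZ
    · exact (hQ i).1 _ _ hZY (hQY i hi)

theorem DenseHereditary.and {P Q : Set ℕ → Prop} (hP : DenseHereditary P)
    (hQ : DenseHereditary Q) : DenseHereditary fun X => P X ∧ Q X := by
  refine ⟨fun X Y h hY => ⟨hP.1 X Y h hY.1, hQ.1 X Y h hY.2⟩, fun X hX => ?_⟩
  obtain ⟨Y, hYX, hY, hPY⟩ := hP.2 X hX
  obtain ⟨Z, hZY, hZ, hQZ⟩ := hQ.2 Y hY
  exact ⟨Z, hZY.trans hYX, hZ, hP.1 _ _ hZY hPY, hQZ⟩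

/-- The elements of `Y` lying above all elements of `t`. -/
def above (t : Finset ℕ) (Y : Set ℕ) : Set ℕ := {y ∈ Y | ∀ a ∈ t, a < y}

theorem above_subset (t : Finset ℕ) (Y : Set ℕ) : above t Y ⊆ Y := fun _ h => h.1

theorem above_mono (t : Finset ℕ) {Y Z : Set ℕ} (h : Y ⊆ Z) : above t Y ⊆ above t Z :=
  fun _ hy => ⟨h hy.1, hy.2⟩

@[simp] theorem above_empty (Y : Set ℕ) : above ∅ Y = Y := by simp [above]

theorem infinite_above (t : Finset ℕ) {Y : Set ℕ} (hY : Y.Infinite) : (above t Y).Infinite := by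
  refine (hY.sdiff (Set.finite_Iic (t.sup id))).mono fun y hy => ⟨hy.1, fun a ha => ?_⟩
  have h : a ≤ t.sup id := Finset.le_sup (f := id) ha
  have := hy.2
  simp only [Set.mem_Iic, not_le] at this
  omega

/-- Diagonalization of dense hereditary properties indexed by finite sets. -/
theorem exists_fusion {Q : Finset ℕ → Set ℕ → Prop} (hQ : ∀ s, DenseHereditary (Q s))
    {X : Set ℕ} (hX : X.Infinite) :
    ∃ Y ⊆ X, Y.Infinite ∧ ∀ s : Finset ℕ, ↑s ⊆ Y → Q s (above s Y) := by
  classical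
  let S := {p : Finset ℕ × Set ℕ //
    p.2.Infinite ∧ (∀ a ∈ p.1, ∀ b ∈ p.2, a < b) ∧ ∀ s ⊆ p.1, Q s p.2}
  have hstep : ∀ p : S, ∃ q : ℕ × S,
      q.1 ∈ p.1.2 ∧ q.2.1.1 = insert q.1 p.1.1 ∧ q.2.1.2 ⊆ p.1.2 := by
    rintro ⟨⟨F, Z⟩, hZ, hFZ, hQF⟩
    obtain ⟨a, ha⟩ := hZ.nonempty
    obtain ⟨W, hWZ, hW, hQW⟩ := (DenseHereditary.forall_mem_finset hQ (insert a F).powerset).2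
      (above {a} Z) (infinite_above _ hZ)
    refine ⟨⟨a, ⟨insert a F, W⟩, hW, fun c hc b hb => ?_, fun s hs => ?_⟩, ha, rfl,
      hWZ.trans (above_subset _ _)⟩
    · obtain rfl | hc := Finset.mem_insert.1 hc
      · exact (hWZ hb).2 _ (by simp)
      · exact hFZ c hc b (hWZ hb).1
    · exact hQW s (Finset.mem_powerset.2 hs)
  choose step hmem hins hsub using hstep
  obtain ⟨X₀, hX₀X, hX₀, hQ₀⟩ := (hQ ∅).2 X hX
  let p : ℕ → S := fun k => Nat.rec
    ⟨⟨∅, X₀⟩, hX₀, by simp, fun s hs => by rwa [Finset.subset_empty.1 hs]⟩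
    (fun _ q => (step q).2) k
  let a : ℕ → ℕ := fun k => (step (p k)).1
  have hp1 : ∀ k, (p (k + 1)).1.1 = insert (a k) (p k).1.1 := fun k => hins _
  have hp2 : Antitone fun k => (p k).1.2 := antitone_nat_of_succ_le fun k => hsub _
  have hF : Monotone fun k => (p k).1.1 := monotone_nat_of_le_succ fun k => by
    rw [hp1]; exact Finset.subset_insert _ _
  have ha1 : ∀ k, a k ∈ (p (k + 1)).1.1 := fun k => by rw [hp1]; simp
  have ha2 : ∀ k, a k ∈ (p k).1.2 := fun k => hmem _
  have ha : StrictMono a := strictMono_nat_of_lt_succ fun k =>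
    (p (k + 1)).2.2.1 _ (ha1 k) _ (ha2 (k + 1))
  refine ⟨Set.range a, ?_, Set.infinite_range_of_injective ha.injective, fun s hs => ?_⟩
  · rintro _ ⟨k, rfl⟩
    exact hX₀X (hp2 (Nat.zero_le k) (ha2 k))
  · suffices ∃ k, s ⊆ (p k).1.1 ∧ above s (Set.range a) ⊆ (p k).1.2 by
      obtain ⟨k, hk, hk'⟩ := this
      exact (hQ s).1 _ _ hk' ((p k).2.2.2 s hk)
    obtain rfl | hne := s.eq_empty_or_nonempty
    · refine ⟨0, by simp, ?_⟩
      rintro _ ⟨⟨k, rfl⟩, -⟩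
      exact hp2 (Nat.zero_le k) (ha2 k)
    · obtain ⟨k, hk⟩ := hs (s.max'_mem hne)
      refine ⟨k + 1, fun x hx => ?_, ?_⟩
      · obtain ⟨j, rfl⟩ := hs hx
        have hjk : j ≤ k := ha.le_iff_le.1 (hk ▸ s.le_max' _ hx)
        exact hF (Nat.succ_le_succ hjk) (ha1 j)
      · rintro _ ⟨⟨j, rfl⟩, hj⟩
        have hkj : k < j := ha.lt_iff_lt.1 (hk ▸ hj _ (s.max'_mem hne))
        exact hp2 hkj (ha2 j)

/-- The infinite sets containing `s` and contained in `s ∪ Y`. -/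
def cube (s : Finset ℕ) (Y : Set ℕ) : Set Ellentuck := {C | ↑s ⊆ C.1 ∧ C.1 ⊆ ↑s ∪ Y}

theorem cube_mono (s : Finset ℕ) {Y Z : Set ℕ} (h : Y ⊆ Z) : cube s Y ⊆ cube s Z :=
  fun _ hC => ⟨hC.1, hC.2.trans (Set.union_subset_union_right _ h)⟩

theorem nonempty_cube (s : Finset ℕ) {Y : Set ℕ} (hY : Y.Infinite) : (cube s Y).Nonempty :=
  ⟨⟨↑s ∪ Y, hY.mono Set.subset_union_right⟩, Set.subset_union_left, subset_rfl⟩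

theorem measurableSet_cube (s : Finset ℕ) (Y : Set ℕ) : MeasurableSet (cube s Y) := by
  have hm : ∀ n : ℕ, MeasurableSet {C : Ellentuck | n ∈ C.1} := fun n =>
    measurableSet_setOfPred.2 ((measurable_set_mem n).comp measurable_subtype_coe)
  have : cube s Y = (⋂ n ∈ s, {C : Ellentuck | n ∈ C.1}) ∩
      ⋂ n ∈ ((↑s ∪ Y)ᶜ : Set ℕ), {C : Ellentuck | n ∈ C.1}ᶜ := by
    ext C
    simp only [cube, Set.mem_inter_iff, Set.mem_iInter, Set.mem_ofPred_eq, Set.mem_compl_iff]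
    refine and_congr Iff.rfl ⟨fun h n hn hC => hn (h hC), fun h n hn => ?_⟩
    by_contra hc
    exact h n hc hn
  rw [this]
  exact (MeasurableSet.biInter (Set.to_countable _) fun n _ => hm n).inter
    (MeasurableSet.biInter (Set.to_countable _) fun n _ => (hm n).compl)

/-- An element of a cube lies in the subcube determined by an initial segment of its free part. -/
theorem exists_initial_segment {s : Finset ℕ} {W : Set ℕ} {C : Ellentuck} (hC : C ∈ cube s W)
    (i : ℕ) : ∃ t : Finset ℕ, ↑t ⊆ W ∧ (∃ a ∈ t, i ≤ a) ∧ C ∈ cube (s ∪ t) (above t W) := by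
  classical
  have hD : (C.1 \ s).Infinite := C.2.sdiff s.finite_toSet
  obtain ⟨a, ha, hia⟩ := hD.exists_gt i
  refine ⟨{x ∈ Finset.range (a + 1) | x ∈ C.1 \ s}, fun x hx => ?_,
    ⟨a, by simpa using ha, hia.le⟩, ?_, fun x hx => ?_⟩
  · have hx : x < a + 1 ∧ x ∈ C.1 \ s := by simpa using hx
    exact (hC.2 hx.2.1).resolve_left hx.2.2
  · intro x hx
    obtain hx | hx := by simpa using hx
    · exact hC.1 hx
    · exact hx.2.1
  · by_cases hxs : x ∈ s
    · exact Or.inl (by simp [hxs])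
    by_cases hxa : x < a + 1
    · exact Or.inl (by simp [hx, hxs, Nat.lt_succ_iff.1 hxa])
    · refine Or.inr ⟨(hC.2 hx).resolve_left hxs, fun b hb => ?_⟩
      have := (Finset.mem_filter.1 hb).1
      simp only [Finset.mem_range] at this
      omega

/-- The cube determined by `s` and `Y` is contained in or disjoint from `P`. -/
def Decides (P : Set Ellentuck) (s : Finset ℕ) (Y : Set ℕ) : Prop :=
  cube s Y ⊆ P ∨ cube s Y ⊆ Pᶜ

theorem Decides.anti {P : Set Ellentuck} {s : Finset ℕ} {Y Z : Set ℕ} (hYZ : Y ⊆ Z)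
    (h : Decides P s Z) : Decides P s Y :=
  h.imp (cube_mono s hYZ).trans (cube_mono s hYZ).trans

/-- A set is completely Ramsey if every cube can be shrunk to a cube that is contained in it or
disjoint from it. -/
def CompletelyRamsey (P : Set Ellentuck) : Prop := ∀ s, DenseHereditary (Decides P s)

theorem CompletelyRamsey.compl {P : Set Ellentuck} (hP : CompletelyRamsey P) :
    CompletelyRamsey Pᶜ := by
  have : Decides Pᶜ = Decides P := by
    funext s Y
    simp only [Decides, compl_compl, or_comm]
  simpa only [CompletelyRamsey, this] using hP

theorem completelyRamsey_empty : CompletelyRamsey ∅ := fun _ =>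
  ⟨fun _ _ h hY => hY.anti h, fun X hX => ⟨X, subset_rfl, hX, Or.inr (by simp)⟩⟩

theorem completelyRamsey_mem (n : ℕ) : CompletelyRamsey {C | n ∈ C.1} := fun s => by
  refine ⟨fun _ _ h hY => hY.anti h, fun X hX =>
    ⟨X \ {n}, Set.sdiff_subset, hX.sdiff (Set.finite_singleton n), ?_⟩⟩
  by_cases hn : n ∈ s
  · exact Or.inl fun C hC => hC.1 hn
  · refine Or.inr fun C hC hnC => ?_
    obtain h | h := hC.2 hnC
    · exact hn h
    · exact h.2 rfl

theorem CompletelyRamsey.iUnion {P : ℕ → Set Ellentuck} (hP : ∀ i, CompletelyRamsey (P i)) :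
    CompletelyRamsey (⋃ i, P i) := by
  classical
  refine fun s => ⟨fun _ _ h hY => hY.anti h, fun X hX => ?_⟩
  let accepts : Finset ℕ → Set ℕ → Prop := fun t Z => cube (s ∪ t) Z ⊆ ⋃ i, P i
  let rejects : Finset ℕ → Set ℕ → Prop := fun t Z => ∀ V ⊆ Z, V.Infinite → ¬ accepts t V
  have hdecide : ∀ t, DenseHereditary fun Z => accepts t Z ∨ rejects t Z := by
    refine fun t => ⟨fun U V h hV => hV.imp (fun hV => (cube_mono _ h).trans hV)
      fun hV W hW => hV W (hW.trans h), fun Z hZ => ?_⟩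
    by_cases hr : rejects t Z
    · exact ⟨Z, subset_rfl, hZ, Or.inr hr⟩
    · simp only [rejects, not_forall, not_not] at hr
      obtain ⟨V, hVZ, hV, ha⟩ := hr
      exact ⟨V, hVZ, hV, Or.inl ha⟩
  obtain ⟨Y, hYX, hY, hYQ⟩ := exists_fusion (fun t => (hdecide t).and
    (DenseHereditary.forall_mem_finset (fun i => hP i (s ∪ t)) (Finset.range (t.sup id + 1)))) hX
  by_cases hacc : accepts ∅ Y
  · exact ⟨Y, hYX, hY, Or.inl (by simpa [accepts] using hacc)⟩
  have hrej : rejects ∅ Y := by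
    simpa using (hYQ ∅ (by simp)).1.resolve_left (by simpa using hacc)
  have hspread : ∀ t : Finset ℕ, DenseHereditary fun Z => ↑t ⊆ Y → rejects t (above t Y) →
      ∀ n ∈ Z, n ∈ above t Y → rejects (insert n t) (above (insert n t) Y) := by
    refine fun t => ⟨fun U V h hV h1 h2 n hn => hV h1 h2 n (h hn), fun Z hZ => ?_⟩
    by_cases hcond : ↑t ⊆ Y ∧ rejects t (above t Y)
    swap
    · exact ⟨Z, subset_rfl, hZ, fun h1 h2 => absurd ⟨h1, h2⟩ hcond⟩
    obtain ⟨htY, ht⟩ := hcond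
    let bad : Set ℕ := {n ∈ above t Y | ¬ rejects (insert n t) (above (insert n t) Y)}
    have hbad : bad.Finite := by
      by_contra hinf
      refine ht bad (fun n hn => hn.1) hinf fun C hC => ?_
      have hD : (C.1 \ ↑(s ∪ t)).Infinite := C.2.sdiff (Finset.finite_toSet _)
      let n := sInf (C.1 \ ↑(s ∪ t))
      have hn : n ∈ C.1 \ ↑(s ∪ t) := Nat.sInf_mem hD.nonempty
      have hnbad : n ∈ bad := (hC.2 hn.1).resolve_left hn.2
      have hsub : ↑(insert n t) ⊆ Y := by
        rw [Finset.coe_insert]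
        exact Set.insert_subset hnbad.1.1 htY
      refine (hYQ _ hsub).1.resolve_right hnbad.2 ⟨fun x hx => ?_, fun x hx => ?_⟩
      · simp only [Finset.union_insert, Finset.coe_insert, Set.mem_insert_iff] at hx
        obtain rfl | hx := hx
        · exact hn.1
        · exact hC.1 hx
      · simp only [Finset.union_insert, Finset.coe_insert]
        by_cases hxst : x ∈ (↑(s ∪ t) : Set ℕ)
        · exact Or.inl (Or.inr hxst)
        obtain rfl | hxn := eq_or_ne x n
        · exact Or.inl (Or.inl rfl)
        have hnx : n < x := lt_of_le_of_ne (Nat.sInf_le ⟨hx, hxst⟩) hxn.symm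
        have hxbad : x ∈ bad := (hC.2 hx).resolve_left hxst
        refine Or.inr ⟨hxbad.1.1, fun b hb => ?_⟩
        obtain rfl | hb := Finset.mem_insert.1 hb
        · exact hnx
        · exact hxbad.1.2 b hb
    refine ⟨Z \ bad, Set.sdiff_subset, hZ.sdiff hbad, fun _ _ n hn hnt => ?_⟩
    by_contra hr
    exact hn.2 ⟨hnt, hr⟩
  obtain ⟨W, hWY, hW, hWQ⟩ := exists_fusion hspread hY
  have hall : ∀ t : Finset ℕ, ↑t ⊆ W → rejects t (above t Y) := by
    intro t
    induction t using Finset.induction_on_max with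
    | empty => simpa using hrej
    | insert a t hat ih =>
      intro h
      rw [Finset.coe_insert, Set.insert_subset_iff] at h
      exact hWQ t h.2 (h.2.trans hWY) (ih h.2) a ⟨h.1, hat⟩ ⟨hWY h.1, hat⟩
  refine ⟨W, hWY.trans hYX, hW, Or.inr fun C hC hCP => ?_⟩
  obtain ⟨i, hi⟩ := Set.mem_iUnion.1 hCP
  obtain ⟨t, htW, ⟨a, hat, hia⟩, hCt⟩ := exists_initial_segment hC i
  have hsup : a ≤ t.sup id := Finset.le_sup (f := id) hat
  have hdec := ((hYQ t (htW.trans hWY)).2 i (Finset.mem_range.2 (by omega))).anti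
    (above_mono t hWY)
  refine hall t htW (above t W) (above_mono t hWY) (infinite_above t hW) ?_
  exact (hdec.resolve_right fun h => h hCt hi).trans (Set.subset_iUnion P i)

/-- The Galvin–Prikry theorem. -/
theorem MeasurableSet.completelyRamsey {P : Set Ellentuck} (hP : MeasurableSet P) :
    CompletelyRamsey P := by
  let m : MeasurableSpace Ellentuck :=
    { MeasurableSet' := CompletelyRamsey
      measurableSet_empty := completelyRamsey_empty
      measurableSet_compl := fun _ h => h.compl
      measurableSet_iUnion := fun _ h => CompletelyRamsey.iUnion h }
  have hval : @Measurable _ _ m _ (Subtype.val : Ellentuck → Set ℕ) :=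
    measurable_set_iff.2 fun n => measurableSet_setOfPred.1 (completelyRamsey_mem n)
  exact hval.comap_le P hP

/-- Every cube shrinks to one contained in a piece of a given finite Borel cover. -/
theorem exists_cube_subset_mem {𝒦 : Set (Set Ellentuck)} (hfin : 𝒦.Finite)
    (hmeas : ∀ K ∈ 𝒦, MeasurableSet K) (hcov : ⋃₀ 𝒦 = Set.univ) (s : Finset ℕ)
    {X : Set ℕ} (hX : X.Infinite) : ∃ Y ⊆ X, Y.Infinite ∧ ∃ K ∈ 𝒦, cube s Y ⊆ K := by
  have := hfin.fintype
  obtain ⟨Y, hYX, hY, hdec⟩ := (DenseHereditary.forall_mem_finset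
    (fun K : 𝒦 => (hmeas K.1 K.2).completelyRamsey s) Finset.univ).2 X hX
  obtain ⟨C, hC⟩ := nonempty_cube s hY
  obtain ⟨K, hK, hCK⟩ := Set.mem_sUnion.1 (hcov.symm ▸ Set.mem_univ C)
  exact ⟨Y, hYX, hY, K, hK,
    (hdec ⟨K, hK⟩ (Finset.mem_univ _)).resolve_right fun h => h hC hCK⟩

end Ramsey

section BorelGraphs

variable {X Y : Type*} [MeasurableSpace X] [StandardBorelSpace X]
  [MeasurableSpace Y] [StandardBorelSpace Y]

/-- A Borel set with sections of bounded finite cardinality has Borel projection. -/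
theorem measurableSet_exists_of_card_le {R : X → Y → Prop} {d : ℕ}
    (hR : MeasurableSet {p : X × Y | R p.1 p.2})
    (hd : ∀ x, ∃ F : Finset Y, F.card ≤ d ∧ ∀ y, R x y → y ∈ F) :
    MeasurableSet {x | ∃ y, R x y} := by
  classical
  induction d generalizing R with
  | zero =>
    have : {x | ∃ y, R x y} = ∅ := by
      ext x
      obtain ⟨F, hF, h⟩ := hd x
      rw [Nat.le_zero, Finset.card_eq_zero] at hF
      simpa [hF] using h
    rw [this]
    exact .empty
  | succ d ih =>
    obtain ⟨φ, hφ⟩ := MeasureTheory.exists_measurableEmbedding_real Y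
    let T : Set (X × (Fin (d + 1) → Y)) :=
      {p | (∀ i, R p.1 (p.2 i)) ∧ ∀ i j, i < j → φ (p.2 i) < φ (p.2 j)}
    have hev : ∀ i, Measurable fun p : X × (Fin (d + 1) → Y) => p.2 i := fun i =>
      (measurable_pi_apply i).comp measurable_snd
    have hT : MeasurableSet T := by
      have : T = (⋂ i, {p | R p.1 (p.2 i)}) ∩
          ⋂ i, ⋂ j, ⋂ (_ : i < j), {p | φ (p.2 i) < φ (p.2 j)} := by
        ext p
        simp [T]
      rw [this]
      exact (MeasurableSet.iInter fun i => (measurable_fst.prodMk (hev i)) hR).inter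
        (MeasurableSet.iInter fun i => MeasurableSet.iInter fun j => MeasurableSet.iInter fun _ =>
          measurableSet_lt (hφ.measurable.comp (hev i)) (hφ.measurable.comp (hev j)))
    have hinj : Set.InjOn Prod.fst T := by
      rintro ⟨x, v⟩ ⟨hv, hvm⟩ ⟨x', w⟩ ⟨hw, hwm⟩ (rfl : x = x')
      obtain ⟨F, hF, h⟩ := hd x
      have hrange : ∀ u : Fin (d + 1) → Y, (∀ i, R x (u i)) →
          StrictMono (φ ∘ u) → Set.range u = F := by
        intro u hu hum
        have hsub : Finset.univ.image u ⊆ F := by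
          intro y hy
          obtain ⟨i, -, rfl⟩ := Finset.mem_image.1 hy
          exact h _ (hu i)
        have hcard : (Finset.univ.image u).card = d + 1 := by
          rw [Finset.card_image_of_injective _ hum.injective.of_comp, Finset.card_fin]
        rw [← Finset.eq_of_subset_of_card_le hsub (by rwa [hcard])]
        simp
      have hv' : StrictMono (φ ∘ v) := fun i j hij => hvm i j hij
      have hw' : StrictMono (φ ∘ w) := fun i j hij => hwm i j hij
      have hvw : φ ∘ v = φ ∘ w := (hv'.range_inj hw').1 (by
        rw [Set.range_comp, Set.range_comp, hrange v hv hv', hrange w hw hw'])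
      exact Prod.ext rfl (hφ.injective.comp_left hvw)
    have hP : MeasurableSet (Prod.fst '' T) := hT.image_of_measurable_injOn measurable_fst hinj
    have hrest := ih (R := fun x y => R x y ∧ x ∉ Prod.fst '' T)
      (hR.inter (measurable_fst hP.compl)) (fun x => ?_)
    · have : {x | ∃ y, R x y} = Prod.fst '' T ∪ {x | ∃ y, R x y ∧ x ∉ Prod.fst '' T} := by
        ext x
        by_cases hx : x ∈ Prod.fst '' T
        · simp only [Set.mem_union, hx, true_or, iff_true]
          obtain ⟨p, hp, rfl⟩ := hx
          exact ⟨_, hp.1 0⟩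
        · simp only [Set.mem_union, hx, false_or, Set.mem_ofPred_eq, not_false_eq_true, and_true]
      rw [this]
      exact hP.union hrest
    · obtain ⟨F, hF, h⟩ := hd x
      refine ⟨{y ∈ F | R x y ∧ x ∉ Prod.fst '' T}, ?_, fun y hy =>
        Finset.mem_filter.2 ⟨h y hy.1, hy⟩⟩
      by_contra! hlt
      have hE : (({y ∈ F | R x y ∧ x ∉ Prod.fst '' T}).image φ).card = d + 1 := by
        rw [Finset.card_image_of_injective _ hφ.injective]
        exact le_antisymm ((Finset.card_filter_le _ _).trans hF) hlt
      have hsec : ∀ i, ∃ y, (R x y ∧ x ∉ Prod.fst '' T) ∧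
          φ y = Finset.orderEmbOfFin _ hE i := fun i => by
        obtain ⟨y, hy, hyi⟩ := Finset.mem_image.1 (Finset.orderEmbOfFin_mem _ hE i)
        exact ⟨y, (Finset.mem_filter.1 hy).2, hyi⟩
      choose v hv hvφ using hsec
      refine (hv 0).2 ⟨(x, v), ⟨fun i => (hv i).1, fun i j hij => ?_⟩, rfl⟩
      simp only [hvφ]
      exact (Finset.orderEmbOfFin _ hE).strictMono hij

/-- In a Borel graph of bounded degree, the neighborhood of a Borel set is Borel. -/
theorem BorelGraph.measurableSet_neighbors {H : SimpleGraph X} (hH : BorelGraph H) {d : ℕ}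
    (hd : ∀ x, ∃ F : Finset X, F.card ≤ d ∧ ∀ y, H.Adj x y → y ∈ F)
    {M : Set X} (hM : MeasurableSet M) : MeasurableSet {x | ∃ y, H.Adj x y ∧ y ∈ M} :=
  measurableSet_exists_of_card_le (hH.inter (measurable_snd hM)) fun x => by
    obtain ⟨F, hF, h⟩ := hd x
    exact ⟨F, hF, fun y hy => h y hy.1⟩

/-- A Borel graph of bounded degree has a countable cover by Borel independent sets. -/
theorem BorelGraph.exists_countable_cover {H : SimpleGraph X} (hH : BorelGraph H) {d : ℕ}
    (hd : ∀ x, ∃ F : Finset X, F.card ≤ d ∧ ∀ y, H.Adj x y → y ∈ F) :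
    ∃ A : ℕ → Set X, (∀ i, MeasurableSet (A i)) ∧
      (∀ i, ∀ x ∈ A i, ∀ y ∈ A i, ¬ H.Adj x y) ∧ ∀ x, ∃ i, x ∈ A i := by
  let := upgradeStandardBorel X
  obtain hX | ⟨⟨x₀⟩⟩ := isEmpty_or_nonempty X
  · exact ⟨fun _ => ∅, fun _ => .empty, by simp, fun x => hX.elim x⟩
  obtain ⟨V, hV, -⟩ := (TopologicalSpace.isBasis_countableBasis X).exists_subset_of_mem_open
    (Set.mem_univ x₀) isOpen_univ
  obtain ⟨U, hU⟩ := (TopologicalSpace.countable_countableBasis X).exists_eq_range ⟨V, hV⟩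
  have hbasis := hU ▸ TopologicalSpace.isBasis_countableBasis X
  have hUm : ∀ i, MeasurableSet (U i) := fun i => (hbasis.isOpen ⟨i, rfl⟩).measurableSet
  refine ⟨fun i => U i \ {x | ∃ y, H.Adj x y ∧ y ∈ U i},
    fun i => (hUm i).diff (hH.measurableSet_neighbors hd (hUm i)),
    fun i x hx y hy hxy => hx.2 ⟨y, hxy, hy.1⟩, fun x => ?_⟩
  obtain ⟨F, -, hF⟩ := hd x
  have hN : {y | H.Adj x y}.Finite := F.finite_toSet.subset fun y hy => hF y hy
  obtain ⟨_, ⟨i, rfl⟩, hxi, hi⟩ := hbasis.exists_subset_of_mem_open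
    (show x ∈ {y | H.Adj x y}ᶜ from H.irrefl) hN.isClosed.isOpen_compl
  exact ⟨i, hxi, fun ⟨y, hxy, hy⟩ => hi hy hxy⟩

/-- In a Borel graph of bounded degree, every Borel set contains a maximal independent Borel
subset. -/
theorem BorelGraph.exists_maximal_independent {H : SimpleGraph X} (hH : BorelGraph H) {d : ℕ}
    (hd : ∀ x, ∃ F : Finset X, F.card ≤ d ∧ ∀ y, H.Adj x y → y ∈ F)
    {Z : Set X} (hZ : MeasurableSet Z) :
    ∃ M ⊆ Z, MeasurableSet M ∧ (∀ x ∈ M, ∀ y ∈ M, ¬ H.Adj x y) ∧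
      ∀ x ∈ Z \ M, ∃ y ∈ M, H.Adj x y := by
  obtain ⟨A, hAm, hA, hcov⟩ := hH.exists_countable_cover hd
  let M : ℕ → Set X := fun k => Nat.rec ∅
    (fun i N => N ∪ ((A i ∩ Z) \ {x | ∃ y, H.Adj x y ∧ y ∈ N})) k
  have hM : ∀ i, M (i + 1) = M i ∪ ((A i ∩ Z) \ {x | ∃ y, H.Adj x y ∧ y ∈ M i}) := fun _ => rfl
  have hmono : Monotone M := monotone_nat_of_le_succ fun i => by
    rw [hM]; exact Set.subset_union_left
  have hmeas : ∀ i, MeasurableSet (M i) := fun i => by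
    induction i with
    | zero => exact .empty
    | succ i ih =>
      rw [hM]
      exact ih.union (((hAm i).inter hZ).diff (hH.measurableSet_neighbors hd ih))
  have hind : ∀ i, ∀ x ∈ M i, ∀ y ∈ M i, ¬ H.Adj x y := fun i => by
    induction i with
    | zero => exact fun x hx => hx.elim
    | succ i ih =>
      rw [hM]
      rintro x (hx | hx) y (hy | hy) hxy
      · exact ih x hx y hy hxy
      · exact hy.2 ⟨x, hxy.symm, hx⟩
      · exact hx.2 ⟨y, hxy, hy⟩
      · exact hA i x hx.1.1 y hy.1.1 hxy
  have hMZ : ∀ i, M i ⊆ Z := fun i => by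
    induction i with
    | zero => exact fun x hx => hx.elim
    | succ i ih =>
      rw [hM]
      exact Set.union_subset ih fun x hx => hx.1.2
  refine ⟨⋃ i, M i, Set.iUnion_subset hMZ, .iUnion hmeas, fun x hx y hy => ?_, ?_⟩
  · obtain ⟨i, hi⟩ := Set.mem_iUnion.1 hx
    obtain ⟨j, hj⟩ := Set.mem_iUnion.1 hy
    exact hind (max i j) x (hmono (le_max_left i j) hi) y (hmono (le_max_right i j) hj)
  · rintro x ⟨hxZ, hx⟩
    obtain ⟨i, hi⟩ := hcov x
    by_contra hno
    refine hx (Set.mem_iUnion.2 ⟨i + 1, hM i ▸ Or.inr ⟨⟨hi, hxZ⟩, ?_⟩⟩)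
    rintro ⟨y, hxy, hy⟩
    exact hno ⟨y, Set.mem_iUnion.2 ⟨i, hy⟩, hxy⟩

/-- A Borel graph of bounded degree has a finite Borel chromatic number. -/
theorem BorelGraph.exists_finite_cover {H : SimpleGraph X} (hH : BorelGraph H) {d : ℕ}
    (hd : ∀ x, ∃ F : Finset X, F.card ≤ d ∧ ∀ y, H.Adj x y → y ∈ F) :
    ∃ 𝒦 : Set (Set X), 𝒦.Finite ∧ (∀ K ∈ 𝒦, MeasurableSet K) ∧
      (∀ K ∈ 𝒦, ∀ x ∈ K, ∀ y ∈ K, ¬ H.Adj x y) ∧ ⋃₀ 𝒦 = Set.univ := by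
  classical
  suffices ∀ n, ∀ Z : Set X, MeasurableSet Z →
      (∀ x ∈ Z, ∃ F : Finset X, F.card < n ∧ ∀ y ∈ Z, H.Adj x y → y ∈ F) →
      ∃ 𝒦 : Set (Set X), 𝒦.Finite ∧ (∀ K ∈ 𝒦, MeasurableSet K) ∧
        (∀ K ∈ 𝒦, ∀ x ∈ K, ∀ y ∈ K, ¬ H.Adj x y) ∧ Z ⊆ ⋃₀ 𝒦 by
    obtain ⟨𝒦, h1, h2, h3, h4⟩ := this (d + 1) Set.univ .univ fun x _ => by
      obtain ⟨F, hF, h⟩ := hd x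
      exact ⟨F, Nat.lt_succ_of_le hF, fun y _ => h y⟩
    exact ⟨𝒦, h1, h2, h3, Set.univ_subset_iff.1 h4⟩
  intro n
  induction n with
  | zero =>
    intro Z _ h
    refine ⟨∅, Set.finite_empty, by simp, by simp, fun x hx => ?_⟩
    obtain ⟨F, hF, -⟩ := h x hx
    exact absurd hF (Nat.not_lt_zero _)
  | succ n ih =>
    intro Z hZ h
    obtain ⟨M, hMZ, hM, hMind, hMmax⟩ := hH.exists_maximal_independent hd hZ
    obtain ⟨𝒦, h1, h2, h3, h4⟩ := ih (Z \ M) (hZ.diff hM) fun x hx => by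
      obtain ⟨F, hF, hxF⟩ := h x hx.1
      obtain ⟨y, hy, hxy⟩ := hMmax x hx
      have hyF := hxF y (hMZ hy) hxy
      refine ⟨F.erase y, ?_, fun z hz hxz => Finset.mem_erase.2 ⟨?_, hxF z hz.1 hxz⟩⟩
      · have := Finset.card_erase_add_one hyF
        omega
      · rintro rfl
        exact hz.2 hy
    refine ⟨insert M 𝒦, h1.insert M, ?_, ?_, fun x hx => ?_⟩
    · rintro K (rfl | hK)
      exacts [hM, h2 K hK]
    · rintro K (rfl | hK)
      exacts [hMind, h3 K hK]
    · by_cases hxM : x ∈ M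
      · exact ⟨M, Set.mem_insert _ _, hxM⟩
      · obtain ⟨K, hK, hxK⟩ := h4 ⟨hx, hxM⟩
        exact ⟨K, Set.mem_insert_of_mem _ hK, hxK⟩

/-- Reachability by a walk of length at most `k` in a Borel graph of bounded degree is contained
in a Borel relation with bounded sections. -/
theorem BorelGraph.exists_measurable_ball {G : SimpleGraph X} (hG : BorelGraph G)
    (hdeg : BddDegreeGraph G) (k : ℕ) :
    ∃ R : X → X → Prop, MeasurableSet {p : X × X | R p.1 p.2} ∧
      (∃ b, ∀ x, ∃ F : Finset X, F.card ≤ b ∧ ∀ y, R x y → y ∈ F) ∧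
      (∀ x, R x x) ∧ ∀ x y (w : G.Walk x y), w.length ≤ k → R x y := by
  classical
  obtain ⟨d, hd⟩ := hdeg
  have hdiag : MeasurableSet {p : X × X | p.1 = p.2} :=
    measurableSet_eq_fun measurable_fst measurable_snd
  have hclosed : ∀ x, ∃ F : Finset X, F.card ≤ d + 1 ∧ ∀ y, G.Adj x y ∨ x = y → y ∈ F := by
    intro x
    refine ⟨insert x (hd x).1.toFinset, (Finset.card_insert_le _ _).trans ?_, ?_⟩
    · rw [← Set.ncard_eq_toFinset_card _ (hd x).1]
      exact Nat.succ_le_succ (hd x).2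
    · rintro y (h | rfl)
      · exact Finset.mem_insert_of_mem (by simpa using h)
      · exact Finset.mem_insert_self _ _
  induction k with
  | zero =>
    refine ⟨fun x y => x = y, hdiag, ⟨1, fun x => ⟨{x}, by simp, by simp [eq_comm]⟩⟩,
      fun _ => rfl, fun x y w hw => ?_⟩
    exact SimpleGraph.Walk.eq_of_length_eq_zero (Nat.le_zero.1 hw)
  | succ k ih =>
    obtain ⟨R, hR, ⟨b, hb⟩, hrefl, hw⟩ := ih
    refine ⟨fun x z => ∃ y, (G.Adj x y ∨ x = y) ∧ R y z, ?_, ⟨(d + 1) * b, fun x => ?_⟩,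
      fun x => ⟨x, Or.inr rfl, hrefl x⟩, fun x z w hlen => ?_⟩
    · refine measurableSet_exists_of_card_le (d := d + 1)
        (R := fun (p : X × X) y => (G.Adj p.1 y ∨ p.1 = y) ∧ R y p.2) ?_ fun p => ?_
      · exact MeasurableSet.inter
          ((measurable_fst.fst.prodMk measurable_snd) (MeasurableSet.union hG hdiag))
          ((measurable_snd.prodMk measurable_fst.snd) hR)
      · obtain ⟨F, hF, h⟩ := hclosed p.1
        exact ⟨F, hF, fun y hy => h y hy.1⟩
    · obtain ⟨F, hF, h⟩ := hclosed x
      choose E hE hRE using hb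
      refine ⟨F.biUnion E, (Finset.card_biUnion_le_card_mul F E b fun y _ => hE y).trans
        (Nat.mul_le_mul_right b hF), fun z hz => ?_⟩
      obtain ⟨y, hxy, hyz⟩ := hz
      exact Finset.mem_biUnion.2 ⟨y, h y hxy, hRE y z hyz⟩
    · cases w with
      | nil => exact ⟨x, Or.inr rfl, hrefl x⟩
      | cons hadj w => exact ⟨_, Or.inl hadj, hw _ _ w (Nat.le_of_succ_le_succ hlen)⟩

/-- For each `k`, a Borel graph of bounded degree has a finite cover by `k`-separated Borel
sets. -/
theorem BorelGraph.exists_finite_separated_cover {G : SimpleGraph X} (hG : BorelGraph G)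
    (hdeg : BddDegreeGraph G) (k : ℕ) :
    ∃ 𝒦 : Set (Set X), 𝒦.Finite ∧ (∀ K ∈ 𝒦, MeasurableSet K) ∧
      (∀ K ∈ 𝒦, SeparatedIn G k K) ∧ ⋃₀ 𝒦 = Set.univ := by
  obtain ⟨R, hR, ⟨b, hb⟩, -, hw⟩ := hG.exists_measurable_ball hdeg k
  let H : SimpleGraph X :=
    { Adj := fun x y => x ≠ y ∧ R x y ∧ R y x
      symm := ⟨fun _ _ h => ⟨h.1.symm, h.2.2, h.2.1⟩⟩
      loopless := ⟨fun _ h => h.1 rfl⟩ }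
  have hH : BorelGraph H :=
    (measurableSet_eq_fun measurable_fst measurable_snd).compl.inter
      (hR.inter (measurable_swap hR))
  have hHb : ∀ x, ∃ F : Finset X, F.card ≤ b ∧ ∀ y, H.Adj x y → y ∈ F := fun x => by
    obtain ⟨F, hF, h⟩ := hb x
    exact ⟨F, hF, fun y hy => h y hy.2.1⟩
  obtain ⟨𝒦, h1, h2, h3, h4⟩ := hH.exists_finite_cover hHb
  refine ⟨𝒦, h1, h2, fun K hK x hx y hy hxy => ?_, h4⟩
  by_contra! hle
  obtain ⟨w, hwlen⟩ := SimpleGraph.exists_walk_of_edist_ne_top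
    (ne_top_of_le_ne_top (ENat.natCast_ne_top k) hle)
  have hlen : w.length ≤ k := by
    rw [← hwlen] at hle
    exact_mod_cast hle
  exact h3 K hK x hx y hy
    ⟨hxy, hw x y w hlen, hw y x w.reverse (by rwa [SimpleGraph.Walk.length_reverse])⟩

end BorelGraphs

instance : StandardBorelSpace Ellentuck := by
  have : StandardBorelSpace (Set ℕ) := inferInstanceAs (StandardBorelSpace (ℕ → Prop))
  refine MeasurableSet.standardBorel (s := {A : Set ℕ | A.Infinite}) ?_
  have : {A : Set ℕ | A.Infinite} = ⋂ n, ⋃ m, ⋃ (_ : n < m), {A : Set ℕ | m ∈ A} := by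
    ext A
    simp only [Set.mem_iInter, Set.mem_iUnion, Set.mem_ofPred_eq]
    exact ⟨fun hA n => (hA.exists_gt n).imp fun m hm => ⟨hm.2, hm.1⟩,
      fun h => Set.infinite_of_forall_exists_gt fun n => (h n).imp fun m ⟨h1, h2⟩ => ⟨h2, h1⟩⟩
  rw [this]
  exact .iInter fun n => .iUnion fun m => .iUnion fun _ =>
    measurableSet_setOfPred.2 (measurable_set_mem m)

/-- Sufficiently separated covers exist on cubes of the Ellentuck space. -/
theorem exists_separated_cover_on_cube
    (G : ℕ → SimpleGraph Ellentuck)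
    (hGBorel : ∀ n, BorelGraph (G n))
    (hGdeg : ∀ n, BddDegreeGraph (G n))
    (f : ℕ → ℕ) :
    ∃ A : Set ℕ, A.Infinite ∧
      ∃ B : ℕ → Set Ellentuck,
        (∀ n, MeasurableSet (B n)) ∧
        (∀ n, SeparatedIn (G n) (f n) (B n)) ∧
        ∀ C : Ellentuck, C.1 ⊆ A → ∃ᶠ n in Filter.atTop, C ∈ B n := by
  have hsep : ∀ s : Finset ℕ, DenseHereditary fun Y =>
      SeparatedIn (G (Encodable.encode s)) (f (Encodable.encode s)) (cube s Y) := by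
    refine fun s => ⟨fun Y Z h hZ x hx y hy => hZ x (cube_mono s h hx) y (cube_mono s h hy),
      fun X hX => ?_⟩
    obtain ⟨𝒦, h1, h2, h3, h4⟩ := (hGBorel (Encodable.encode s)).exists_finite_separated_cover
      (hGdeg _) (f (Encodable.encode s))
    obtain ⟨Y, hYX, hY, K, hK, hsub⟩ := exists_cube_subset_mem h1 h2 h4 s hX
    exact ⟨Y, hYX, hY, fun x hx y hy => h3 K hK x (hsub hx) y (hsub hy)⟩
  obtain ⟨A, -, hA, hAQ⟩ := exists_fusion hsep Set.infinite_univ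
  refine ⟨A, hA, fun n => ⋃ s : Finset ℕ, ⋃ (_ : Encodable.encode s = n ∧ ↑s ⊆ A),
    cube s (above s A), fun n => .iUnion fun s => .iUnion fun _ => measurableSet_cube _ _,
    fun n x hx y hy => ?_, fun C hC => ?_⟩
  · simp only [Set.mem_iUnion] at hx hy
    obtain ⟨s, ⟨rfl, hs⟩, hx⟩ := hx
    obtain ⟨t, ⟨hts, -⟩, hy⟩ := hy
    obtain rfl := Encodable.encode_injective hts
    exact hAQ t hs x hx y hy
  · have hC' : C ∈ cube ∅ A := ⟨by simp, by simpa using hC⟩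
    rw [Nat.frequently_atTop_iff_infinite]
    let T : Set (Finset ℕ) := {t | ↑t ⊆ A ∧ C ∈ cube t (above t A)}
    have hT : T.Infinite := by
      intro hfin
      obtain ⟨t, htA, ⟨a, hat, hia⟩, hCt⟩ :=
        exists_initial_segment hC' (hfin.toFinset.sup (fun t => t.sup id) + 1)
      have htT : t ∈ hfin.toFinset := hfin.mem_toFinset.2 ⟨htA, by simpa using hCt⟩
      have h1 : a ≤ t.sup id := Finset.le_sup (f := id) hat
      have h2 := Finset.le_sup (f := fun t : Finset ℕ => t.sup id) htT
      omega
    refine (hT.image Encodable.encode_injective.injOn).mono ?_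
    rintro _ ⟨t, ht, rfl⟩
    exact Set.mem_iUnion.2 ⟨t, Set.mem_iUnion.2 ⟨⟨rfl, ht.1⟩, ht.2⟩⟩
end

section
/- Let X be a Polish space, let (Gₙ)ₙ be a sequence of bounded-degree Borel graphs on X, and let f : ℕ → ℕ. Then there exist Borel sets Bₙ ⊆ X such that each Bₙ is f(n)-separated in Gₙ, and the set {x ∈ X : x ∈ Bₙ for infinitely many n} is comeager in X. -/
open Set Filter Topology MeasureTheory

/-- A Borel set in a product whose vertical sections have uniformly bounded size has a Borel
projection. -/
theorem MeasurableSet.image_fst_of_encard_section_le {X Y : Type*}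
    [MeasurableSpace X] [StandardBorelSpace X] [MeasurableSpace Y] [StandardBorelSpace Y]
    {P : Set (X × Y)} (hP : MeasurableSet P) {d : ℕ}
    (hd : ∀ x, {y | (x, y) ∈ P}.encard ≤ d) : MeasurableSet (Prod.fst '' P) := by
  induction d generalizing P with
  | zero =>
    have : P = ∅ := by
      ext ⟨x, y⟩
      have := hd x
      simp only [Nat.cast_zero, nonpos_iff_eq_zero, encard_eq_zero] at this
      simpa using fun h => (this ▸ h : y ∈ (∅ : Set Y))
    simp [this]
  | succ d ih =>
    set e : Y → ℝ := embeddingReal Y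
    have he : MeasurableEmbedding e := measurableEmbedding_embeddingReal Y
    -- Increasing enumerations of the sections with exactly `d + 1` elements.
    let C : Set (X × (Fin (d + 1) → Y)) :=
      {q | (∀ i j, i < j → e (q.2 i) < e (q.2 j)) ∧ ∀ i, (q.1, q.2 i) ∈ P}
    have hC : MeasurableSet C := by
      have h₁ : MeasurableSet {q : X × (Fin (d + 1) → Y) |
          ∀ i j, i < j → e (q.2 i) < e (q.2 j)} := by
        simp only [ofPred_forall]
        refine .iInter fun i => .iInter fun j => .iInter fun _ => ?_
        exact measurableSet_lt (he.measurable.comp ((measurable_pi_apply i).comp measurable_snd))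
          (he.measurable.comp ((measurable_pi_apply j).comp measurable_snd))
      have h₂ : MeasurableSet {q : X × (Fin (d + 1) → Y) | ∀ i, (q.1, q.2 i) ∈ P} := by
        simp only [ofPred_forall]
        refine .iInter fun i => ?_
        exact (measurable_fst.prodMk ((measurable_pi_apply i).comp measurable_snd)) hP
      exact h₁.inter h₂
    have hrange : ∀ q ∈ C, range q.2 = {y | (q.1, y) ∈ P} := by
      rintro ⟨x, v⟩ ⟨hv, hvP⟩
      have hinj : Function.Injective v :=
        Function.Injective.of_comp (f := e) (StrictMono.injective fun i j => hv i j)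
      refine Finite.eq_of_subset_of_encard_le ?_ (range_subset_iff.2 hvP) ?_
      · exact finite_range v
      · rw [← image_univ, hinj.encard_image]
        simpa using hd x
    have hinj : InjOn Prod.fst C := by
      rintro ⟨x, v⟩ hv ⟨x', w⟩ hw (rfl : x = x')
      have hvw : range (e ∘ v) = range (e ∘ w) := by
        rw [range_comp, range_comp, hrange _ hv, hrange _ hw]
      have := (StrictMono.range_inj (f := e ∘ v) (g := e ∘ w) (fun i j => hv.1 i j)
        (fun i j => hw.1 i j)).1 hvw
      rw [Prod.mk.injEq]
      exact ⟨rfl, he.injective.comp_left this⟩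
    have hD : MeasurableSet (Prod.fst '' C) :=
      hC.image_of_measurable_injOn measurable_fst hinj
    have hrest := ih (P := P \ (Prod.fst ⁻¹' (Prod.fst '' C))) (hP.diff (measurable_fst hD)) <| by
      intro x
      by_cases hx : x ∈ Prod.fst '' C
      · have : {y | (x, y) ∈ P \ (Prod.fst ⁻¹' (Prod.fst '' C))} = ∅ := by
          exact eq_empty_of_forall_notMem fun y hy => hy.2 hx
        rw [this, encard_empty]
        exact zero_le
      · refine (encard_le_encard (t := {y | (x, y) ∈ P}) fun y hy => hy.1).trans ?_
        by_contra! hlt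
        obtain ⟨t, htP, ht⟩ := exists_subset_encard_eq (Order.add_one_le_of_lt hlt)
        have hte : (e '' t).encard = ((d + 1 : ℕ) : ℕ∞) := by
          rw [he.injective.encard_image, ht]
          push_cast
          rfl
        have htfin := finite_of_encard_eq_coe hte
        have hcard : htfin.toFinset.card = d + 1 := by
          rw [htfin.encard_eq_coe_toFinset_card] at hte
          exact_mod_cast hte
        have hmem : ∀ i, ∃ y ∈ t, e y = htfin.toFinset.orderEmbOfFin hcard i := fun i =>
          htfin.mem_toFinset.1 (htfin.toFinset.orderEmbOfFin_mem hcard i)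
        choose v hvt hv using hmem
        refine hx ⟨(x, v), ⟨fun i j hij => ?_, fun i => htP (hvt i)⟩, rfl⟩
        simpa [hv] using hij
    convert hD.union hrest using 1
    ext x
    constructor
    · rintro ⟨p, hp, rfl⟩
      by_cases hx : p.1 ∈ Prod.fst '' C
      · exact Or.inl hx
      · exact Or.inr ⟨p, ⟨hp, hx⟩, rfl⟩
    · rintro (⟨q, hq, rfl⟩ | ⟨p, hp, rfl⟩)
      · exact ⟨(q.1, q.2 0), hq.2 0, rfl⟩
      · exact ⟨p, hp.1, rfl⟩

/-- Composition of Borel relations with uniformly bounded sections is Borel with uniformly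
bounded sections. -/
theorem measurableSet_comp_of_encard_section_le {X : Type*} [MeasurableSpace X]
    [StandardBorelSpace X] {P Q : Set (X × X)} (hP : MeasurableSet P) (hQ : MeasurableSet Q)
    {a b : ℕ} (ha : ∀ x, {y | (x, y) ∈ P}.encard ≤ a) (hb : ∀ x, {y | (x, y) ∈ Q}.encard ≤ b) :
    MeasurableSet {p : X × X | ∃ z, (p.1, z) ∈ P ∧ (z, p.2) ∈ Q} ∧
      ∀ x, {y | ∃ z, (x, z) ∈ P ∧ (z, y) ∈ Q}.encard ≤ (a * b : ℕ) := by
  constructor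
  · have hR : MeasurableSet {r : (X × X) × X | (r.1.1, r.2) ∈ P ∧ (r.2, r.1.2) ∈ Q} :=
      ((show Measurable fun r : (X × X) × X => (r.1.1, r.2) by fun_prop) hP).inter
        ((show Measurable fun r : (X × X) × X => (r.2, r.1.2) by fun_prop) hQ)
    convert hR.image_fst_of_encard_section_le (d := a) fun p =>
      (encard_le_encard fun y hy => hy.1).trans (ha p.1) using 1
    ext p
    simp
  · intro x
    have hfin : {z | (x, z) ∈ P}.Finite := finite_of_encard_le_coe (ha x)
    have hsub : {y | ∃ z, (x, z) ∈ P ∧ (z, y) ∈ Q} ⊆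
        ⋃ z ∈ hfin.toFinset, {y | (z, y) ∈ Q} := by
      rintro y ⟨z, hz, hy⟩
      simp only [Finite.mem_toFinset, mem_iUnion]
      exact ⟨z, hz, hy⟩
    refine (encard_le_encard hsub).trans ((Finset.set_encard_biUnion_le _ _).trans ?_)
    refine (Finset.sum_le_card_nsmul _ _ _ fun z _ => hb z).trans ?_
    have := ha x
    rw [hfin.encard_eq_coe_toFinset_card, Nat.cast_le] at this
    rw [nsmul_eq_mul, Nat.cast_mul]
    gcongr

/-- In a bounded-degree Borel graph, the relation of being at distance at most `k` is Borel with
uniformly bounded sections. -/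
theorem BorelGraph.measurableSet_edist_le {X : Type*} [MeasurableSpace X]
    [StandardBorelSpace X] {G : SimpleGraph X} (hG : BorelGraph G) (hd : BddDegreeGraph G)
    (k : ℕ) : MeasurableSet {p : X × X | G.edist p.1 p.2 ≤ k} ∧
      ∃ d : ℕ, ∀ x, {y | G.edist x y ≤ k}.encard ≤ d := by
  obtain ⟨d, hd⟩ := hd
  have hball : MeasurableSet {p : X × X | G.Adj p.1 p.2 ∨ p.1 = p.2} :=
    MeasurableSet.union hG measurableSet_diagonal
  have hsec : ∀ x, {y | G.Adj x y ∨ x = y}.encard ≤ (d + 1 : ℕ) := by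
    intro x
    have h : {y | G.Adj x y ∨ x = y} = {y | G.Adj x y} ∪ {x} := by
      ext y
      simp [eq_comm, or_comm]
    rw [h]
    refine (encard_union_le _ _).trans ?_
    rw [encard_singleton, ← (hd x).1.cast_ncard_eq]
    push_cast
    gcongr
    exact (hd x).2
  have hsucc : ∀ (k : ℕ) (x y : X), G.edist x y ≤ (k + 1 : ℕ) ↔
      ∃ z, G.edist x z ≤ k ∧ (G.Adj z y ∨ z = y) := by
    intro k x y
    constructor
    · intro h
      obtain ⟨p, hp⟩ := G.exists_walk_of_edist_ne_top (ne_top_of_le_ne_top (by simp) h)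
      rw [← hp, Nat.cast_le] at h
      by_cases hn : p.Nil
      · exact ⟨x, by simp, .inr hn.eq⟩
      · refine ⟨p.penultimate, ?_, .inl (p.adj_penultimate hn)⟩
        refine (SimpleGraph.Walk.edist_le p.dropLast).trans ?_
        have := p.length_dropLast_add_one hn
        exact_mod_cast (by omega : p.dropLast.length ≤ k)
    · rintro ⟨z, hz, h⟩
      refine G.edist_triangle.trans (?_ : G.edist x z + G.edist z y ≤ _)
      push_cast
      exact add_le_add hz (SimpleGraph.edist_le_one_iff_adj_or_eq.2 h)
  induction k with
  | zero =>
    refine ⟨?_, 1, fun x => ?_⟩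
    · convert measurableSet_diagonal (α := X) using 1
      ext p
      simp
    · simp
  | succ k ih =>
    obtain ⟨hk, a, ha⟩ := ih
    have := measurableSet_comp_of_encard_section_le hk hball ha hsec
    simp only [mem_ofPred_eq] at this
    simp only [hsucc]
    exact ⟨this.1, _, this.2⟩

/-- A bounded-degree Borel graph on a Polish space is covered by
countably many Borel `k`-separated sets. -/
theorem exists_measurableSet_separatedIn_iUnion_eq_univ {X : Type*} [TopologicalSpace X]
    [PolishSpace X] [MeasurableSpace X] [BorelSpace X] {G : SimpleGraph X}
    (hG : BorelGraph G) (hd : BddDegreeGraph G) (k : ℕ) :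
    ∃ A : ℕ → Set X, (∀ i, MeasurableSet (A i)) ∧ (∀ i, SeparatedIn G k (A i)) ∧
      ⋃ i, A i = univ := by
  obtain ⟨hR, d, hsec⟩ := hG.measurableSet_edist_le hd k
  obtain ⟨U, hU⟩ : ∃ U : ℕ → Set X, TopologicalSpace.IsTopologicalBasis (range U) := by
    obtain ⟨b, hbc, -, hb⟩ := TopologicalSpace.exists_countable_basis X
    obtain ⟨U, hU⟩ := (hbc.insert ∅).exists_eq_range (insert_nonempty _ _)
    exact ⟨U, hU ▸ hb.insert_empty⟩
  have hUo : ∀ i, IsOpen (U i) := fun i => hU.isOpen (mem_range_self i)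
  let N : ℕ → Set X := fun i =>
    Prod.fst '' {p : X × X | G.edist p.1 p.2 ≤ k ∧ p.1 ≠ p.2 ∧ p.2 ∈ U i}
  have hN : ∀ i, MeasurableSet (N i) := fun i => by
    refine MeasurableSet.image_fst_of_encard_section_le (d := d) ?_ fun x =>
      (encard_le_encard fun y hy => hy.1).trans (hsec x)
    exact hR.inter (measurableSet_diagonal.compl.inter (measurable_snd (hUo i).measurableSet))
  refine ⟨fun i => U i \ N i, fun i => (hUo i).measurableSet.diff (hN i), ?_, ?_⟩
  · intro i x hx y hy hxy
    by_contra! h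
    exact hx.2 ⟨(x, y), ⟨h, hxy, hy.1⟩, rfl⟩
  · refine eq_univ_of_forall fun x => mem_iUnion.2 ?_
    have hfin : ({y | G.edist x y ≤ k} \ {x}).Finite := (finite_of_encard_le_coe (hsec x)).sdiff
    obtain ⟨_, ⟨i, rfl⟩, hxi, hi⟩ := hU.exists_subset_of_mem_open
      (show x ∈ ({y | G.edist x y ≤ k} \ {x})ᶜ by simp) hfin.isClosed.isOpen_compl
    refine ⟨i, hxi, ?_⟩
    rintro ⟨⟨x', y⟩, ⟨h, hne, hy⟩, rfl⟩
    exact hi hy ⟨h, fun hyx => hne hyx.symm⟩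

/-- A Borel set that is nonmeagre in every member of a basis of nonempty sets is comeagre. -/
theorem MeasurableSet.mem_residual_of_not_isMeagre_inter {X : Type*} [TopologicalSpace X]
    [MeasurableSpace X] [BorelSpace X] {b : Set (Set X)}
    (hb : TopologicalSpace.IsTopologicalBasis b) {W : Set X} (hW : MeasurableSet W)
    (h : ∀ V ∈ b, V.Nonempty → ¬ IsMeagre (W ∩ V)) : W ∈ residual X := by
  obtain ⟨O, hO, hWO⟩ := hW.compl.residualEq_isOpen
  have hempty : O = ∅ := by
    by_contra! hne
    obtain ⟨x, hx⟩ := hne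
    obtain ⟨V, hV, hxV, hVO⟩ := hb.exists_subset_of_mem_open hx hO
    refine h V hV ⟨x, hxV⟩ ?_
    rw [IsMeagre]
    filter_upwards [eventuallyEq_set.1 hWO] with y hy hyWV
    exact hy.2 (hVO hyWV.2) hyWV.1
  filter_upwards [eventuallyEq_set.1 hWO] with y hy
  by_contra hyW
  simpa [hempty] using hy.1 hyW

/-- Sufficiently separated covers exist on a comeager set of any Polish space. -/
theorem exists_separated_cover_comeager
    {X : Type*} [TopologicalSpace X] [PolishSpace X]
    [MeasurableSpace X] [BorelSpace X]
    (G : ℕ → SimpleGraph X)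
    (hGBorel : ∀ n, BorelGraph (G n))
    (hGdeg : ∀ n, BddDegreeGraph (G n))
    (f : ℕ → ℕ) :
    ∃ B : ℕ → Set X,
      (∀ n, MeasurableSet (B n)) ∧
      (∀ n, SeparatedIn (G n) (f n) (B n)) ∧
      {x : X | ∃ᶠ n in Filter.atTop, x ∈ B n} ∈ residual X := by
  choose A hA hAsep hAcov using fun n =>
    exists_measurableSet_separatedIn_iUnion_eq_univ (hGBorel n) (hGdeg n) (f n)
  obtain ⟨V, hV⟩ : ∃ V : ℕ → Set X, TopologicalSpace.IsTopologicalBasis (range V) := by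
    obtain ⟨b, hbc, -, hb⟩ := TopologicalSpace.exists_countable_basis X
    obtain ⟨V, hV⟩ := (hbc.insert ∅).exists_eq_range (insert_nonempty _ _)
    exact ⟨V, hV ▸ hb.insert_empty⟩
  -- At stage `n`, make `B n` nonmeagre in `V n.unpair.1`; every basic set is met infinitely often.
  have hc : ∀ n, ∃ i, (V n.unpair.1).Nonempty → ¬ IsMeagre (A n i ∩ V n.unpair.1) := by
    intro n
    by_contra! h
    refine not_isMeagre_of_isOpen (hV.isOpen (mem_range_self n.unpair.1)) (h 0).1 ?_
    rw [← univ_inter (V n.unpair.1), ← hAcov n, iUnion_inter]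
    exact isMeagre_iUnion fun i => (h i).2
  choose c hc using hc
  refine ⟨fun n => A n (c n), fun n => hA n _, fun n => hAsep n _, ?_⟩
  have key : ∀ N, (⋃ n ≥ N, A n (c n)) ∈ residual X := by
    intro N
    refine MeasurableSet.mem_residual_of_not_isMeagre_inter hV
      (.iUnion fun n => .iUnion fun _ => hA n _) ?_
    rintro _ ⟨j, rfl⟩ hne hmeagre
    have := hc (Nat.pair j N)
    rw [Nat.unpair_pair] at this
    refine this hne (hmeagre.mono (inter_subset_inter_left _ ?_))
    exact subset_biUnion_of_mem (u := fun n => A n (c n)) (Nat.right_le_pair j N)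
  filter_upwards [countable_iInter_mem.2 key] with x hx
  refine frequently_atTop.2 fun N => ?_
  simpa using mem_iInter.1 hx N
end

section
/- Let G' be a graph (symmetric irreflexive relation) on a set X, let H ⊆ G' be a subgraph such that every connected component of H has diameter at most m with respect to the path distance of H, let m' ∈ ℕ satisfy m' ≥ m + 2 and m' ≥ 2·(m+1), and let B' ⊆ X be m'-separated in G'. Define the graph H' = H ∪ {(x,y) ∈ G' : x ∈ B' or y ∈ B'}. Then every connected component of H' has diameter at most m' with respect to the path distance of H'. Moreover, every connected component of H' contains at most one point of B'. -/
/-- Adjacency after enlarging `H` by all edges of `G'` touching `B`. -/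
theorem adj_sup_fromRel_iff {X : Type*} {G' H : SimpleGraph X} {B : Set X} {x y : X} :
    (H ⊔ SimpleGraph.fromRel (fun x y => G'.Adj x y ∧ (x ∈ B ∨ y ∈ B))).Adj x y ↔
      H.Adj x y ∨ (G'.Adj x y ∧ (x ∈ B ∨ y ∈ B)) := by
  simp only [SimpleGraph.sup_adj, SimpleGraph.fromRel_adj]
  constructor
  · rintro (h | ⟨-, h | ⟨h, hB⟩⟩)
    · exact Or.inl h
    · exact Or.inr h
    · exact Or.inr ⟨h.symm, hB.symm⟩
  · rintro (h | h)
    · exact Or.inl h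
    · exact Or.inr ⟨h.1.ne, Or.inl h⟩

/-- If the components of `H ≤ K` have diameter at most `m`, then a point in the `H`-component of
`b` or of a `K`-neighbour of `b` is at `K`-distance at most `m + 1` from `b`. -/
theorem edist_le_of_reachable_of_eq_or_adj {X : Type*} {K H : SimpleGraph X} (hHK : H ≤ K) {m : ℕ}
    (hH : ∀ x y : X, H.Reachable x y → H.edist x y ≤ (m : ℕ∞)) {b z x : X}
    (hz : z = b ∨ K.Adj b z) (hzx : H.Reachable z x) : K.edist b x ≤ ((m + 1 : ℕ) : ℕ∞) := by
  have h₁ : K.edist b z ≤ 1 := by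
    rcases hz with rfl | h
    · simp
    · exact (SimpleGraph.edist_eq_one_iff_adj.mpr h).le
  have h₂ : K.edist z x ≤ m := (SimpleGraph.edist_anti hHK).trans (hH z x hzx)
  calc K.edist b x ≤ K.edist b z + K.edist z x := SimpleGraph.edist_triangle
    _ ≤ 1 + m := add_le_add h₁ h₂
    _ = ((m + 1 : ℕ) : ℕ∞) := by push_cast; exact add_comm _ _

/-- If `B` is `(m + 2)`-separated, then the component of `b ∈ B` after adding all edges touching
`B` consists of the `H`-components of `b` and of its `G'`-neighbours. -/
theorem exists_eq_or_adj_and_reachable {X : Type*} {G' H K : SimpleGraph X} (hHG : H ≤ G')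
    {m k : ℕ} (hH : ∀ x y : X, H.Reachable x y → H.edist x y ≤ (m : ℕ∞)) (hk : m + 2 ≤ k)
    {B : Set X} (hsep : SeparatedIn G' k B)
    (hK : ∀ x y, K.Adj x y → H.Adj x y ∨ (G'.Adj x y ∧ (x ∈ B ∨ y ∈ B)))
    {b x : X} (hb : b ∈ B) (hbx : K.Reachable b x) :
    ∃ z, (z = b ∨ G'.Adj b z) ∧ H.Reachable z x := by
  have eq_of_le : ∀ c ∈ B, G'.edist b c ≤ ((m + 2 : ℕ) : ℕ∞) → b = c := by
    intro c hc hle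
    by_contra hne
    exact (hsep b hb c hc hne).not_ge (hle.trans (by exact_mod_cast hk))
  rw [SimpleGraph.reachable_iff_reflTransGen] at hbx
  induction hbx with
  | refl => exact ⟨b, Or.inl rfl, .refl b⟩
  | @tail x y _ hxy ih =>
    obtain ⟨z, hz, hzx⟩ := ih
    have hx := edist_le_of_reachable_of_eq_or_adj hHG hH hz hzx
    rcases hK x y hxy with h | ⟨h, hxB | hyB⟩
    · exact ⟨z, hz, hzx.trans h.reachable⟩
    · obtain rfl := eq_of_le x hxB (hx.trans (by exact_mod_cast Nat.le_succ _))
      exact ⟨y, Or.inr h, .refl y⟩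
    · have hy : G'.edist b y ≤ ((m + 2 : ℕ) : ℕ∞) :=
        calc G'.edist b y ≤ G'.edist b x + G'.edist x y := SimpleGraph.edist_triangle
          _ ≤ ((m + 1 : ℕ) : ℕ∞) + 1 :=
            add_le_add hx (SimpleGraph.edist_eq_one_iff_adj.mpr h).le
          _ = ((m + 2 : ℕ) : ℕ∞) := by norm_cast
      obtain rfl := eq_of_le y hyB hy
      exact ⟨b, Or.inl rfl, .refl b⟩

/-- Inductive step for sufficiently separated covers: enlarging a subgraph `H` of `G'`
with components of diameter `≤ m` by all `G'`-edges touching an `m'`-separated set `B'`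
yields a graph whose components have diameter `≤ m'` and meet `B'` in at most one point. -/
theorem components_bounded_diameter_step
    {X : Type*} (G' H : SimpleGraph X) (hHG : H ≤ G')
    (m m' : ℕ)
    (hHdiam : ∀ x y : X, H.Reachable x y → H.edist x y ≤ (m : ℕ∞))
    (hm1 : m' ≥ m + 2) (hm2 : m' ≥ 2 * (m + 1))
    (B' : Set X) (hsep : SeparatedIn G' m' B') :
    ∀ H' : SimpleGraph X,
      H' = H ⊔ SimpleGraph.fromRel (fun x y => G'.Adj x y ∧ (x ∈ B' ∨ y ∈ B')) →
      (∀ x y : X, H'.Reachable x y → H'.edist x y ≤ (m' : ℕ∞)) ∧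
      (∀ x ∈ B', ∀ y ∈ B', H'.Reachable x y → x = y) := by
  rintro K hKdef
  have hK : ∀ x y, K.Adj x y ↔ H.Adj x y ∨ (G'.Adj x y ∧ (x ∈ B' ∨ y ∈ B')) := by
    intro x y
    rw [hKdef]
    exact adj_sup_fromRel_iff
  have hHK : H ≤ K := fun x y h => (hK x y).mpr (Or.inl h)
  have near : ∀ b ∈ B', ∀ x, K.Reachable b x →
      ∃ z, (z = b ∨ G'.Adj b z) ∧ H.Reachable z x := fun b hb x hbx =>
    exists_eq_or_adj_and_reachable hHG hHdiam hm1 hsep (fun x y => (hK x y).mp) hb hbx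
  have radius : ∀ b ∈ B', ∀ x, K.Reachable b x → K.edist b x ≤ ((m + 1 : ℕ) : ℕ∞) := by
    intro b hb x hbx
    obtain ⟨z, hz, hzx⟩ := near b hb x hbx
    exact edist_le_of_reachable_of_eq_or_adj hHK hHdiam
      (hz.imp_right fun h => (hK b z).mpr (Or.inr ⟨h, Or.inl hb⟩)) hzx
  refine ⟨fun x y hxy => ?_, fun b hb c hc hbc => ?_⟩
  · by_cases hB : ∃ b ∈ B', K.Reachable b x
    · obtain ⟨b, hb, hbx⟩ := hB
      calc K.edist x y ≤ K.edist x b + K.edist b y := SimpleGraph.edist_triangle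
        _ ≤ ((m + 1 : ℕ) : ℕ∞) + ((m + 1 : ℕ) : ℕ∞) :=
          add_le_add (SimpleGraph.edist_comm.trans_le (radius b hb x hbx))
            (radius b hb y (hbx.trans hxy))
        _ ≤ (m' : ℕ∞) := by norm_cast; omega
    · have hHxy : H.Reachable x y := by
        rw [SimpleGraph.reachable_iff_reflTransGen] at hxy
        induction hxy with
        | refl => exact .refl x
        | @tail u v hxu huv ih =>
          have hxu' := (SimpleGraph.reachable_iff_reflTransGen x u).mpr hxu
          rcases (hK u v).mp huv with h | ⟨-, hu | hv⟩
          · exact ih.trans h.reachable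
          · exact absurd ⟨u, hu, hxu'.symm⟩ hB
          · exact absurd ⟨v, hv, (hxu'.trans huv.reachable).symm⟩ hB
      exact (SimpleGraph.edist_anti hHK).trans ((hHdiam x y hHxy).trans (by norm_cast; omega))
  · obtain ⟨z, hz, hzc⟩ := near b hb c hbc
    by_contra hne
    refine (hsep b hb c hc hne).not_ge ?_
    exact (edist_le_of_reachable_of_eq_or_adj hHG hHdiam hz hzc).trans (by norm_cast; omega)
end
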